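/- Let G be a simple graph on a finite vertex set V with |V| = n, let C be an initial configuration, and let a quantum circuit with exactly two levels L_0, L_1 with interactions I_0, I_1 be given. If d_I is the minimum total delay over all P2 solutions and d_O is the minimum delay over all P3 solutions, then d_I − d_O ≤ 1. -/

import Mathlib

/-!
Nearest-neighbor optimization of quantum circuits on an arbitrary topology graph.

A topology graph is a simple graph `G` on a finite vertex set `V` with `|V| = n`.
Qubits are indexed by `Fin n` and a configuration is a bijection `Fin n ≃ V`.
A swap layer (matching of `G`) is encoded as an involutive permutation of `V`
moving each non-fixed vertex to an adjacent vertex.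
-/

/-- A swap layer: a matching of the topology graph `G`, encoded as an involutive
permutation of the vertices whose non-fixed points are swapped along edges of `G`. -/
structure SwapLayer {V : Type*} (G : SimpleGraph V) where
  perm : Equiv.Perm V
  invol : ∀ v, perm (perm v) = v
  adj_or_fixed : ∀ v, perm v = v ∨ G.Adj v (perm v)

/-- Applying a list of swap layers to a configuration, in order. -/
def applySwaps {V : Type*} {G : SimpleGraph V} {n : ℕ} (C : Fin n ≃ V)
    (Ms : List (SwapLayer G)) : Fin n ≃ V :=
  Ms.foldl (fun c M => c.trans M.perm) C

/-- A quantum gate on `n` qubits, with a set of control qubits and a target qubit. -/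
structure Gate (n : ℕ) where
  controls : Finset (Fin n)
  target : Fin n
  target_not_control : target ∉ controls

/-- The (nonempty) set of qubits a gate acts on. -/
def Gate.var {n : ℕ} (g : Gate n) : Finset (Fin n) := insert g.target g.controls

/-- A level: a finite set of gates acting on pairwise disjoint sets of qubits. -/
def IsLevel {n : ℕ} (L : Finset (Gate n)) : Prop :=
  (L : Set (Gate n)).Pairwise fun g h => Disjoint g.var h.var

/-- A configuration `c` satisfies the interaction of level `L` if for every gate of `L`
every control qubit is placed adjacent to the target qubit. -/
def Satisfies {V : Type*} (G : SimpleGraph V) {n : ℕ} (c : Fin n ≃ V)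
    (L : Finset (Gate n)) : Prop :=
  ∀ g ∈ L, ∀ q ∈ g.controls, G.Adj (c q) (c g.target)

/-- A P2 solution from initial configuration `C` for a circuit with `k+1` levels
`L 0, …, L k`: a sequence of swap layers together with monotone indices `t j`
such that after the first `t j` swap layers the configuration satisfies the
interaction of level `L j`. -/
structure P2Sol {V : Type*} (G : SimpleGraph V) {n : ℕ} (C : Fin n ≃ V) (k : ℕ)
    (L : Fin (k + 1) → Finset (Gate n)) where
  swaps : List (SwapLayer G)
  t : Fin (k + 1) → ℕ
  mono : Monotone t
  t_le : ∀ j, t j ≤ swaps.length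
  sat : ∀ j, Satisfies G (applySwaps C (swaps.take (t j))) (L j)

/-- Total delay of a P2 solution: swap cycles plus one cycle per level. -/
def P2Sol.totalDelay {V : Type*} {G : SimpleGraph V} {n : ℕ} {C : Fin n ≃ V} {k : ℕ}
    {L : Fin (k + 1) → Finset (Gate n)} (s : P2Sol G C k L) : ℕ :=
  s.swaps.length + (k + 1)

/-- A P3 solution from initial configuration `C` for a circuit with `k+1` levels:
a sequence of cycles, each consisting of a swap layer and at most one executed level.
Levels are executed in order, each in exactly one cycle; a level may be executed in
a cycle only if the configuration at the start of that cycle satisfies its interaction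
and the cycle's swap layer fixes every vertex occupied by a qubit acted on by the level. -/
structure P3Sol {V : Type*} (G : SimpleGraph V) {n : ℕ} (C : Fin n ≃ V) (k : ℕ)
    (L : Fin (k + 1) → Finset (Gate n)) where
  cycles : List (SwapLayer G × Option (Fin (k + 1)))
  exec_order : cycles.filterMap Prod.snd = List.finRange (k + 1)
  sat : ∀ i : Fin cycles.length, ∀ j, (cycles.get i).2 = some j →
    Satisfies G (applySwaps C ((cycles.take i).map Prod.fst)) (L j)
  no_touch : ∀ i : Fin cycles.length, ∀ j, (cycles.get i).2 = some j →
    ∀ g ∈ L j, ∀ q ∈ g.var,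
      (cycles.get i).1.perm (applySwaps C ((cycles.take i).map Prod.fst) q) =
        applySwaps C ((cycles.take i).map Prod.fst) q

/-- Delay of a P3 solution: its number of cycles. -/
def P3Sol.delay {V : Type*} {G : SimpleGraph V} {n : ℕ} {C : Fin n ≃ V} {k : ℕ}
    {L : Fin (k + 1) → Finset (Gate n)} (s : P3Sol G C k L) : ℕ :=
  s.cycles.length


/-- A two-level P3 solution yields a P2 solution whose total delay is larger by at most one:
keep only the swap layers preceding the execution of the second level. -/
theorem P3Sol.exists_p2Sol_totalDelay_le {V : Type*} {G : SimpleGraph V} {n : ℕ}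
    {C : Fin n ≃ V} {L : Fin 2 → Finset (Gate n)} (s : P3Sol G C 1 L) :
    ∃ p : P2Sol G C 1 L, p.totalDelay ≤ s.delay + 1 := by
  have order : s.cycles.filterMap Prod.snd = [0, 1] := s.exec_order
  obtain ⟨l₁, a, l₂, hcycles, -, ha, htail⟩ := List.filterMap_eq_cons_iff.1 order
  obtain ⟨l₃, b, l₄, rfl, -, hb, -⟩ := List.filterMap_eq_cons_iff.1 htail
  have hlen : s.cycles.length = l₁.length + l₃.length + l₄.length + 2 := by
    simp [hcycles]; omega
  have sat₀ := s.sat ⟨l₁.length, by omega⟩ 0 (by simp [hcycles, ha])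
  have sat₁ := s.sat ⟨l₁.length + l₃.length + 1, by omega⟩ 1 (by
    simp [hcycles, hb, add_assoc])
  rw [List.map_take] at sat₀ sat₁
  refine ⟨⟨(s.cycles.map Prod.fst).take (l₁.length + l₃.length + 1),
    ![l₁.length, l₁.length + l₃.length + 1], ?_, ?_, ?_⟩, ?_⟩
  · exact Fin.monotone_iff_le_succ.2 fun i => by fin_cases i; simp; omega
  · rw [Fin.forall_fin_two]; simp [hlen]; omega
  · rw [Fin.forall_fin_two]
    refine ⟨?_, ?_⟩
    · simpa [List.take_take, add_assoc] using sat₀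
    · simpa [List.take_take] using sat₁
  · simp [P2Sol.totalDelay, P3Sol.delay, hlen]

/-- **Theorem (statement 1).** For a topology graph `G` on `n` vertices, an initial
configuration `C`, and a quantum circuit with exactly two levels `L 0, L 1`, the
minimum total delay `dI` over all P2 solutions and the minimum delay `dO` over all
P3 solutions satisfy `dI - dO ≤ 1`. -/
theorem p2_optimal_delay_le_p3_optimal_delay_two_levels
    {V : Type*} [Fintype V] {n : ℕ} (G : SimpleGraph V)
    (hcard : Fintype.card V = n) (C : Fin n ≃ V)
    (L : Fin 2 → Finset (Gate n)) (hL : ∀ j, IsLevel (L j))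
    (dI dO : ℕ)
    (hI : IsLeast {d | ∃ s : P2Sol G C 1 L, s.totalDelay = d} dI)
    (hO : IsLeast {d | ∃ s : P3Sol G C 1 L, s.delay = d} dO) :
    dI - dO ≤ 1 := by
  obtain ⟨s, hs⟩ := hO.1
  obtain ⟨p, hp⟩ := s.exists_p2Sol_totalDelay_le
  have := hI.2 ⟨p, rfl⟩
  omega
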